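/- Let D be an m_D×n real matrix and S an m_S×n real matrix, each having nonconstant columns, and suppose their sample pairwise Pearson correlation matrices coincide: ρ(D_i, D_j) = ρ(S_i, S_j) for all 1 ≤ i, j ≤ n. Let D̂ and Ŝ denote the matrices obtained by z-normalizing each column of D and S respectively. Then for every nonempty subset T ⊆ {1,…,n} of column indices, the multipole correlation of the submatrix of D̂ with columns indexed by T equals the multipole correlation of the submatrix of Ŝ with columns indexed by T. -/

import Mathlib

open scoped BigOperators
open Matrix

/-- Sample mean of a vector in `ℝ^m`. -/
noncomputable def sampleMean {m : ℕ} (x : Fin m → ℝ) : ℝ := (∑ i, x i) / m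

/-- Sample variance (with denominator `m`) of a vector in `ℝ^m`. -/
noncomputable def sampleVar {m : ℕ} (x : Fin m → ℝ) : ℝ :=
  (∑ i, (x i - sampleMean x) ^ 2) / m

/-- Sample standard deviation. -/
noncomputable def sampleStd {m : ℕ} (x : Fin m → ℝ) : ℝ := Real.sqrt (sampleVar x)

/-- A vector is z-normalized if its sample mean is `0` and its sample variance is `1`. -/
def ZNormalized {m : ℕ} (x : Fin m → ℝ) : Prop := sampleMean x = 0 ∧ sampleVar x = 1

/-- A vector is nonconstant if it has two distinct entries. -/
def Nonconstant {m : ℕ} (x : Fin m → ℝ) : Prop := ∃ i j, x i ≠ x j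

/-- Pearson correlation coefficient of two vectors in `ℝ^m`. -/
noncomputable def pearson {m : ℕ} (x y : Fin m → ℝ) : ℝ :=
  (∑ i, (x i - sampleMean x) * (y i - sampleMean y)) /
    (Real.sqrt (∑ i, (x i - sampleMean x) ^ 2) * Real.sqrt (∑ i, (y i - sampleMean y) ^ 2))

/-- z-normalization of a vector. -/
noncomputable def znorm {m : ℕ} (x : Fin m → ℝ) : Fin m → ℝ :=
  fun i => (x i - sampleMean x) / sampleStd x

/-- Multipole correlation of a data matrix `X` (rows = samples, columns = features):
`1` minus the minimal sample variance of `X · v` over (Euclidean) unit vectors `v`. -/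
noncomputable def multipole {m : ℕ} {ι : Type*} [Fintype ι] (X : Matrix (Fin m) ι ℝ) : ℝ :=
  1 - sInf {t | ∃ v : ι → ℝ, ∑ i, v i ^ 2 = 1 ∧ t = sampleVar (X.mulVec v)}

/-- Smallest eigenvalue of a real symmetric (Hermitian) `n × n` matrix, `n > 0`. -/
noncomputable def lambdaMin {n : ℕ} (hn : 0 < n) {C : Matrix (Fin n) (Fin n) ℝ}
    (hC : C.IsHermitian) : ℝ :=
  Finset.univ.inf'
    (by have : Nonempty (Fin n) := Fin.pos_iff_nonempty.mp hn; exact Finset.univ_nonempty)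
    hC.eigenvalues

theorem sampleMean_znorm {m : ℕ} (x : Fin m → ℝ) : sampleMean (znorm x) = 0 := by
  rcases Nat.eq_zero_or_pos m with rfl | hm
  · simp [sampleMean]
  have hm' : (m : ℝ) ≠ 0 := by positivity
  have h : ∑ i, (x i - sampleMean x) = 0 := by
    simp [Finset.sum_sub_distrib, sampleMean, mul_div_cancel₀ _ hm']
  simp only [sampleMean, znorm, ← Finset.sum_div] at h ⊢
  simp [h]

theorem pearson_eq_sum_znorm {m : ℕ} (x y : Fin m → ℝ) :
    pearson x y = (∑ i, znorm x i * znorm y i) / m := by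
  rcases Nat.eq_zero_or_pos m with rfl | hm
  · simp [pearson]
  have hm' : (m : ℝ) ≠ 0 := by positivity
  have hs : √(m : ℝ) * √(m : ℝ) = m := Real.mul_self_sqrt (Nat.cast_nonneg m)
  have hstd : sampleStd x * sampleStd y * m =
      √(∑ i, (x i - sampleMean x) ^ 2) * √(∑ i, (y i - sampleMean y) ^ 2) := by
    simp only [sampleStd, sampleVar, Real.sqrt_div' _ (Nat.cast_nonneg m)]
    rw [div_mul_div_comm, hs, div_mul_cancel₀ _ hm']
  simp only [pearson, znorm, div_mul_div_comm, ← Finset.sum_div]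
  rw [div_div, hstd]

/-- The sample variance of a combination of centered columns is a quadratic form in their
second moments. -/
theorem sampleVar_mulVec_of_sampleMean_eq_zero {m : ℕ} {ι : Type*} [Fintype ι]
    (X : Matrix (Fin m) ι ℝ) (hX : ∀ j, sampleMean (fun i => X i j) = 0) (v : ι → ℝ) :
    sampleVar (X.mulVec v) = ∑ j, ∑ k, v j * v k * ((∑ i, X i j * X i k) / m) := by
  have hmean : sampleMean (X.mulVec v) = 0 := by
    simp only [sampleMean, Matrix.mulVec, dotProduct] at hX ⊢
    rw [Finset.sum_comm, Finset.sum_div]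
    refine Finset.sum_eq_zero fun j _ => ?_
    rw [← Finset.sum_mul, mul_div_right_comm, hX, zero_mul]
  have hsq (i : Fin m) : X.mulVec v i ^ 2 = ∑ j, ∑ k, v j * v k * (X i j * X i k) := by
    simp only [Matrix.mulVec, dotProduct, sq, Finset.sum_mul_sum]
    exact Finset.sum_congr rfl fun j _ => Finset.sum_congr rfl fun k _ => by ring
  simp only [sampleVar, hmean, sub_zero, hsq, ← mul_div_assoc, ← Finset.sum_div, Finset.mul_sum]
  congr 1
  rw [Finset.sum_comm]
  exact Finset.sum_congr rfl fun j _ => Finset.sum_comm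

theorem sampleVar_mulVec_znorm {m n : ℕ} (D : Matrix (Fin m) (Fin n) ℝ) (T : Finset (Fin n))
    (v : T → ℝ) :
    sampleVar ((Matrix.of fun (i : Fin m) (j : T) => znorm (fun k => D k j.1) i).mulVec v) =
      ∑ j, ∑ k, v j * v k * pearson (fun i => D i j.1) (fun i => D i k.1) := by
  simp only [pearson_eq_sum_znorm]
  exact sampleVar_mulVec_of_sampleMean_eq_zero
    (Matrix.of fun (i : Fin m) (j : T) => znorm (fun k => D k j.1) i)
    (fun j => sampleMean_znorm fun k => D k j.1) v

/-- If two data matrices with nonconstant columns have identical sample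
pairwise Pearson correlation matrices, then for every nonempty subset `T` of column indices,
the multipole correlations of the corresponding z-normalized column submatrices coincide. -/
theorem multipole_determined_by_pairwise_correlations {mD mS n : ℕ}
    (D : Matrix (Fin mD) (Fin n) ℝ) (S : Matrix (Fin mS) (Fin n) ℝ)
    (hD : ∀ j, Nonconstant (fun i => D i j)) (hS : ∀ j, Nonconstant (fun i => S i j))
    (hcorr : ∀ i j, pearson (fun k => D k i) (fun k => D k j)
                  = pearson (fun k => S k i) (fun k => S k j)) :
    ∀ T : Finset (Fin n), T.Nonempty →
      multipole (Matrix.of fun (i : Fin mD) (j : T) => znorm (fun k => D k j.1) i)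
        = multipole (Matrix.of fun (i : Fin mS) (j : T) => znorm (fun k => S k j.1) i) := by
  intro T _
  simp only [multipole, sampleVar_mulVec_znorm, hcorr]
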